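/- (Theorem 1, operator form: factorization of the minimal coupling operator.) Let S_A ⊆ Δ^p and T_A ⊆ Δ^{p+1} be subsets, with complements S_{A^c} = Δ^p ∖ S_A and T_B = Δ^{p+1} ∖ T_A. Suppose there exist functions f₁ : (S_A → Ĝ) → C_{p+1}(Ĝ) with values supported on T_A, and f₂ : (S_{A^c} → Ĝ) → C_{p+1}(Ĝ) with values supported on T_B, such that for every k ∈ B_p(Ĝ) one has ∂( f₁(k|_{S_A}) + f₂(k|_{S_{A^c}}) ) = k. Let K_A = { k|_{S_A} : k ∈ B_p(Ĝ) } and K_{A^c} = { k|_{S_{A^c}} : k ∈ B_p(Ĝ) }, and define P_A(k_A) = ∏_{σ ∈ S_A} ( |G|⁻¹ Σ_{g ∈ G} e^{−i k_A(σ)(g)} U_σ(g) ) for k_A : S_A → Ĝ, and P_{A^c}(k_{A^c}) analogously over S_{A^c}; set 𝒰_A = Σ_{k_A ∈ K_A} P_A(k_A) Ũ(f₁(k_A)) and 𝒰_{A^c} = Σ_{k_{A^c} ∈ K_{A^c}} P_{A^c}(k_{A^c}) Ũ(f₂(k_{A^c})). Then for every vector v ∈ H satisfying U(φ) v = v for all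 φ ∈ Z^p(G) and Ũ(k') v = v for all k' ∈ Z_{p+1}(Ĝ), one has 𝒰 v = 𝒰_A 𝒰_{A^c} v. -/

import Mathlib

open Finset

set_option linter.unusedSectionVars false

noncomputable section

/-- The Pontryagin dual `Ĝ = Hom(G, ℝ/2πℤ)` of an abelian group `G`,
where `ℝ/2πℤ` is `Real.Angle = AddCircle (2π)`. -/
abbrev PDual (G : Type) [AddCommGroup G] : Type := G →+ Real.Angle

/-- The dual of a finite abelian group is finite (hence all the `∑ᶠ` sums over
(subsets of) chain groups with coefficients in `PDual G` below are honest
finite sums). -/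
instance PDual.finite (G : Type) [AddCommGroup G] [Fintype G] : Finite (PDual G) := by
  classical
  set n := Fintype.card G with hn
  have hn0 : 0 < n := Fintype.card_pos
  haveI : Fact (0 < 2 * Real.pi) := ⟨by positivity⟩
  have hT0 : Set.Finite {θ : AddCircle (2 * Real.pi) | n • θ = 0} := by
    have hU : Set.Finite
        (⋃ d ∈ Finset.Icc 1 n, {θ : AddCircle (2 * Real.pi) | addOrderOf θ = d}) :=
      Set.Finite.biUnion (Finset.Icc 1 n).finite_toSet
        (fun d hd => AddCircle.finite_setOfPred_addOrderOf_eq (2 * Real.pi)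
          (by simp only [Finset.coe_Icc, Set.mem_Icc] at hd; exact hd.1))
    refine hU.subset ?_
    intro θ hθ
    have hfin : IsOfFinAddOrder θ := by
      rw [isOfFinAddOrder_iff_nsmul_eq_zero]
      exact ⟨n, hn0, hθ⟩
    have hdvd : addOrderOf θ ∣ n := addOrderOf_dvd_of_nsmul_eq_zero hθ
    have hpos : 0 < addOrderOf θ := hfin.addOrderOf_pos
    refine Set.mem_iUnion₂.mpr ⟨addOrderOf θ, ?_, rfl⟩
    simp only [Finset.mem_Icc]
    exact ⟨hpos, Nat.le_of_dvd hn0 hdvd⟩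
  have hT : Set.Finite {θ : Real.Angle | n • θ = 0} := hT0
  haveI : Finite {θ : Real.Angle | n • θ = 0} := hT.to_subtype
  have hinj : Function.Injective
      (fun (k : G →+ Real.Angle) (g : G) =>
        (⟨k g, by
          show n • k g = 0
          rw [← map_nsmul, card_nsmul_eq_zero, map_zero]⟩ :
          {θ : Real.Angle | n • θ = 0})) := by
    intro k₁ k₂ h
    ext g
    have := congrFun h g
    simpa [Subtype.ext_iff] using this
  exact Finite.of_injective _ hinj

/-- The well-defined complex exponential `e^{iθ} = cos θ + i sin θ` for `θ ∈ ℝ/2πℤ`. -/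
def expA (θ : Real.Angle) : ℂ := Real.Angle.cos θ + Real.Angle.sin θ * Complex.I

variable {G : Type} [AddCommGroup G] [Fintype G]

/-- The pairing `⟨k, φ⟩ = ∑_{σ ∈ Δ} k(σ)(φ(σ))` with values in `ℝ/2πℤ`. -/
def pairing {Δ : Type} [Fintype Δ] (k : Δ → PDual G) (φ : Δ → G) : Real.Angle :=
  ∑ σ, k σ (φ σ)

/-- The boundary map `∂`, `(∂k')(σ) = ∑_τ s(τ,σ) • k'(τ)`; its image is the
boundary group `B_p(Ĝ)` and its kernel the cycle group `Z_{p+1}(Ĝ)`. -/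
def bd {A B : Type} [Fintype A] (s : A → B → ℤ) (k' : A → PDual G) : B → PDual G :=
  fun σ => ∑ τ, s τ σ • k' τ

/-- The coboundary map `δ`, `(δφ)(τ) = ∑_σ s(τ,σ) • φ(σ)`; its kernel is the
cocycle group `Z^p(G)` and its image the coboundary group `B^{p+1}(G)`. -/
def cb {A B : Type} [Fintype B] (s : A → B → ℤ) (φ : B → G) : A → G :=
  fun τ => ∑ σ, s τ σ • φ σ

variable {H : Type} [NormedAddCommGroup H] [InnerProductSpace ℂ H]
  [FiniteDimensional ℂ H]

/-- The product of a pairwise-commuting finite family of operators. -/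
def commProd {ι : Type} [Fintype ι] (f : ι → H →L[ℂ] H)
    (h : ∀ i j, Commute (f i) (f j)) : H →L[ℂ] H :=
  Finset.univ.noncommProd f (fun a _ b _ _ => h a b)

variable {Δp Δp1 : Type} [Fintype Δp] [Fintype Δp1]

/-- `U(φ) = ∏_{σ ∈ Δ^p} U_σ(φ(σ))`. -/
def Uop (U : Δp → G → H →L[ℂ] H)
    (hU : ∀ σ σ' g g', Commute (U σ g) (U σ' g')) (φ : Δp → G) : H →L[ℂ] H :=
  commProd (fun σ => U σ (φ σ)) fun σ σ' => hU σ σ' _ _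

/-- The local factor `|G|⁻¹ ∑_{g ∈ G} e^{−i k(σ)(g)} U_σ(g)` of `P(k)`. -/
def Pfactor (U : Δp → G → H →L[ℂ] H) (k : Δp → PDual G) (σ : Δp) : H →L[ℂ] H :=
  (Fintype.card G : ℂ)⁻¹ • ∑ g : G, expA (-(k σ g)) • U σ g

theorem Pfactor_commute (U : Δp → G → H →L[ℂ] H)
    (hU : ∀ σ σ' g g', Commute (U σ g) (U σ' g')) (k : Δp → PDual G)
    (σ σ' : Δp) : Commute (Pfactor U k σ) (Pfactor U k σ') := by
  unfold Pfactor
  apply Commute.smul_left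
  apply Commute.smul_right
  apply Commute.sum_left
  intro g _
  apply Commute.sum_right
  intro g' _
  exact ((hU σ σ' g g').smul_right _).smul_left _

/-- The projector `P(k) = ∏_{σ ∈ Δ^p} ( |G|⁻¹ ∑_{g ∈ G} e^{−i k(σ)(g)} U_σ(g) )`. -/
def Pop (U : Δp → G → H →L[ℂ] H)
    (hU : ∀ σ σ' g g', Commute (U σ g) (U σ' g')) (k : Δp → PDual G) : H →L[ℂ] H :=
  commProd (Pfactor U k) (Pfactor_commute U hU k)

/-- `Ũ(k') = ∏_{τ ∈ Δ^{p+1}} Ũ_τ(k'(τ))`. -/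
def Utop (Ut : Δp1 → PDual G → H →L[ℂ] H)
    (hUt : ∀ τ τ' ρ ρ', Commute (Ut τ ρ) (Ut τ' ρ')) (k' : Δp1 → PDual G) : H →L[ℂ] H :=
  commProd (fun τ => Ut τ (k' τ)) fun τ τ' => hUt τ τ' _ _

/-- The minimal coupling operator `𝒰 = ∑_{k ∈ B_p(Ĝ)} P(k) Ũ(r(k))`, for a fixed
section `r` of the boundary map. -/
def MC (s : Δp1 → Δp → ℤ) (U : Δp → G → H →L[ℂ] H)
    (hU : ∀ σ σ' g g', Commute (U σ g) (U σ' g'))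
    (Ut : Δp1 → PDual G → H →L[ℂ] H)
    (hUt : ∀ τ τ' ρ ρ', Commute (Ut τ ρ) (Ut τ' ρ'))
    (r : (Δp → PDual G) → (Δp1 → PDual G)) : H →L[ℂ] H :=
  ∑ᶠ k ∈ Set.range (bd (G := G) s), Pop U hU k * Utop Ut hUt (r k)

/-- Restriction of a chain to a subset `S` of the simplices. -/
def restr {Δ : Type} (S : Finset Δ) (k : Δ → PDual G) : {σ // σ ∈ S} → PDual G :=
  fun σ => k σ.1

/-- The projector `P_A(k_A) = ∏_{σ ∈ S} ( |G|⁻¹ ∑_{g ∈ G} e^{−i k_A(σ)(g)} U_σ(g) )`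
over a sub-collection `S` of the `p`-simplices. -/
def PopSub (U : Δp → G → H →L[ℂ] H)
    (hU : ∀ σ σ' g g', Commute (U σ g) (U σ' g')) (S : Finset Δp)
    (kA : {σ // σ ∈ S} → PDual G) : H →L[ℂ] H :=
  commProd
    (fun σ : {σ // σ ∈ S} =>
      (Fintype.card G : ℂ)⁻¹ • ∑ g : G, expA (-(kA σ g)) • U σ.1 g)
    (fun σ σ' => by
      apply Commute.smul_left
      apply Commute.smul_right
      apply Commute.sum_left
      intro g _
      apply Commute.sum_right
      intro g' _
      exact ((hU σ.1 σ'.1 g g').smul_right _).smul_left _)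

/-- The subregion minimal coupling operator `∑_{k_A ∈ K} P_A(k_A) Ũ(f(k_A))`. -/
def MCsub (U : Δp → G → H →L[ℂ] H)
    (hU : ∀ σ σ' g g', Commute (U σ g) (U σ' g'))
    (Ut : Δp1 → PDual G → H →L[ℂ] H)
    (hUt : ∀ τ τ' ρ ρ', Commute (Ut τ ρ) (Ut τ' ρ')) (S : Finset Δp)
    (f : ({σ // σ ∈ S} → PDual G) → (Δp1 → PDual G))
    (K : Set ({σ // σ ∈ S} → PDual G)) : H →L[ℂ] H :=
  ∑ᶠ kA ∈ K, PopSub U hU S kA * Utop Ut hUt (f kA)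

theorem expA_eq (θ : Real.Angle) : expA θ = (θ.toCircle : ℂ) := by
  rw [Real.Angle.coe_toCircle]; rfl

theorem expA_add (a b : Real.Angle) : expA (a + b) = expA a * expA b := by
  simp [expA_eq]

theorem expA_zero : expA 0 = 1 := by
  simp [expA_eq]

theorem expA_sum {ι : Type} (t : Finset ι) (f : ι → Real.Angle) :
    expA (∑ i ∈ t, f i) = ∏ i ∈ t, expA (f i) := by
  classical
  induction t using Finset.induction_on with
  | empty => simp [expA_zero]
  | insert a t ha ih => rw [Finset.sum_insert ha, Finset.prod_insert ha, expA_add, ih]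

theorem expA_eq_one {θ : Real.Angle} (h : expA θ = 1) : θ = 0 := by
  have h1 : θ.toCircle = 1 := by
    apply Subtype.ext
    rw [expA_eq] at h
    simpa using h
  have h2 := Real.Angle.arg_toCircle θ
  rw [h1] at h2
  simpa using h2.symm

theorem op_mul_apply (S T : H →L[ℂ] H) (v : H) : (S * T) v = S (T v) := rfl

theorem commProd_eq {A : Type} [CommRing A] [Algebra ℂ A] (e : A →ₐ[ℂ] (H →L[ℂ] H))
    {ι : Type} [Fintype ι] (f : ι → H →L[ℂ] H) (h : ∀ i j, Commute (f i) (f j))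
    (f' : ι → A) (hf : ∀ i, f i = e (f' i)) : commProd f h = e (∏ i, f' i) := by
  have : f = fun i => e (f' i) := funext hf
  subst this
  have h1 := Finset.map_noncommProd Finset.univ f'
    (fun _ _ _ _ _ => Commute.all _ _) e
  have h2 := Finset.noncommProd_eq_prod Finset.univ f'
  exact h1.symm.trans (congrArg e h2)

/-- local factor in the commutative algebra -/
def fac {A : Type} [CommRing A] [Algebra ℂ A] (u : Δp → G → A) (k : PDual G) (σ : Δp) : A :=
  (Fintype.card G : ℂ)⁻¹ • ∑ g : G, expA (-(k g)) • u σ g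

theorem fac_mul {A : Type} [CommRing A] [Algebra ℂ A] (u : Δp → G → A)
    (hu : ∀ σ g g', u σ (g + g') = u σ g * u σ g') (k : PDual G) (σ : Δp) (g₀ : G) :
    fac u k σ * u σ g₀ = expA (k g₀) • fac u k σ := by
  unfold fac
  rw [smul_mul_assoc, smul_comm (expA (k g₀)), Finset.sum_mul]
  congr 1
  rw [Finset.smul_sum]
  refine Fintype.sum_equiv (Equiv.addRight g₀) _ _ ?_
  intro g
  simp only [Equiv.coe_addRight]
  rw [smul_mul_assoc, ← hu, smul_smul, ← expA_add, map_add]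
  congr 2
  abel

section facts
variable {A : Type} [CommRing A] [Algebra ℂ A] (e : A →ₐ[ℂ] (H →L[ℂ] H))
  (U : Δp → G → H →L[ℂ] H) (hU : ∀ σ σ' g g', Commute (U σ g) (U σ' g'))
  (u : Δp → G → A) (hu : ∀ σ g, U σ g = e (u σ g))
  (Ut : Δp1 → PDual G → H →L[ℂ] H)
  (hUt : ∀ τ τ' ρ ρ', Commute (Ut τ ρ) (Ut τ' ρ'))
  (ut : Δp1 → PDual G → A) (hut : ∀ τ ρ, Ut τ ρ = e (ut τ ρ))

theorem Pop_eq (hu : ∀ σ g, U σ g = e (u σ g)) (k : Δp → PDual G) :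
    Pop U hU k = e (∏ σ, fac u (k σ) σ) := by
  apply commProd_eq
  intro σ
  simp [Pfactor, fac, hu]

theorem PopSub_eq (hu : ∀ σ g, U σ g = e (u σ g)) (S : Finset Δp) (k : Δp → PDual G) :
    PopSub U hU S (restr S k) = e (∏ σ ∈ S, fac u (k σ) σ) := by
  rw [← Finset.prod_coe_sort]
  apply commProd_eq
  intro σ
  simp [restr, fac, hu]

theorem Uop_eq (hu : ∀ σ g, U σ g = e (u σ g)) (φ : Δp → G) :
    Uop U hU φ = e (∏ σ, u σ (φ σ)) := by
  apply commProd_eq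
  intro σ
  exact hu _ _

theorem Utop_eq (hut : ∀ τ ρ, Ut τ ρ = e (ut τ ρ)) (k : Δp1 → PDual G) :
    Utop Ut hUt k = e (∏ τ, ut τ (k τ)) := by
  apply commProd_eq
  intro σ
  exact hut _ _

end facts

/-- If `k` annihilates all cocycles, it is a boundary. -/
theorem mem_range_bd (s : Δp1 → Δp → ℤ) (k : Δp → PDual G)
    (hk : ∀ φ : Δp → G, cb s φ = 0 → pairing k φ = 0) : k ∈ Set.range (bd (G := G) s) := by
  classical
  let d : (Δp → G) →+ (Δp1 → G) :=
    { toFun := cb s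
      map_zero' := by ext; simp [cb]
      map_add' := by intro a b; ext; simp [cb, Finset.sum_add_distrib] }
  let κ : (Δp → G) →+ Real.Angle :=
    { toFun := pairing k
      map_zero' := by simp [pairing]
      map_add' := by intro a b; simp [pairing, Finset.sum_add_distrib] }
  let κ' : ((Δp → G) ⧸ d.ker) →+ Real.Angle := QuotientAddGroup.lift d.ker κ hk
  haveI : Fact (0 < 2 * Real.pi) := ⟨by positivity⟩
  haveI : DivisibleBy Real.Angle ℤ :=
    inferInstanceAs (DivisibleBy (AddCircle (2 * Real.pi)) ℤ)
  obtain ⟨h, hh⟩ := (Module.Baer.of_divisible Real.Angle).extension_property_addMonoidHom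
    (QuotientAddGroup.kerLift d) (QuotientAddGroup.kerLift_injective d) κ'
  have key : ∀ φ, h (cb s φ) = pairing k φ := by
    intro φ
    exact DFunLike.congr_fun hh (QuotientAddGroup.mk φ)
  refine ⟨fun τ => h.comp (AddMonoidHom.single (fun _ => G) τ), ?_⟩
  funext σ
  ext g
  have h1 := key (Pi.single σ g)
  have h2 : pairing k (Pi.single σ g) = k σ g := by
    unfold pairing
    rw [Finset.sum_eq_single σ]
    · simp
    · intro b _ hb
      simp [Pi.single_eq_of_ne hb]
    · simp
  have h3 : cb s (Pi.single σ g : Δp → G) = ∑ τ, Pi.single τ (s τ σ • g) := by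
    rw [Finset.univ_sum_single]
    funext τ
    unfold cb
    rw [Finset.sum_eq_single σ]
    · simp
    · intro b _ hb
      simp [Pi.single_eq_of_ne hb]
    · simp
  rw [← h2, ← h1, h3, map_sum]
  simp only [bd, AddMonoidHom.finsetSum_apply]
  refine Finset.sum_congr rfl fun τ _ => ?_
  rw [Pi.single_zsmul, map_zsmul]
  rfl

theorem bd_add (s : Δp1 → Δp → ℤ) (a b : Δp1 → PDual G) : bd s (a + b) = bd s a + bd s b := by
  funext σ
  simp [bd, Finset.sum_add_distrib]

theorem bd_sub (s : Δp1 → Δp → ℤ) (a b : Δp1 → PDual G) : bd s (a - b) = bd s a - bd s b := by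
  rw [eq_sub_iff_add_eq, ← bd_add, sub_add_cancel]

theorem restr_bij [DecidableEq Δp] (S : Finset Δp) :
    Function.Bijective (fun k : Δp → PDual G => (restr S k, restr Sᶜ k)) := by
  constructor
  · intro a b h
    simp only [Prod.mk.injEq] at h
    funext σ
    by_cases hσ : σ ∈ S
    · exact congrFun h.1 ⟨σ, hσ⟩
    · exact congrFun h.2 ⟨σ, Finset.mem_compl.2 hσ⟩
  · rintro ⟨a, b⟩
    refine ⟨fun σ => if hσ : σ ∈ S then a ⟨σ, hσ⟩ else b ⟨σ, Finset.mem_compl.2 hσ⟩, ?_⟩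
    refine Prod.ext ?_ ?_
    · funext σ
      simp [restr, σ.2]
    · funext σ
      have := Finset.mem_compl.1 σ.2
      simp [restr, this]

theorem finsum_mem_apply {κ : Type} [Fintype κ] (K : Set κ) (F : κ → H →L[ℂ] H) (v : H) :
    (∑ᶠ k ∈ K, F k) v = ∑ k, open Classical in if k ∈ K then F k v else 0 := by
  classical
  rw [finsum_mem_def, finsum_eq_sum_of_fintype, ContinuousLinearMap.sum_apply]
  refine Finset.sum_congr rfl fun k _ => ?_
  by_cases hk : k ∈ K <;> simp [hk]

theorem mc_aux [DecidableEq Δp]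
    {A : Type} [CommRing A] [Algebra ℂ A] (e : A →ₐ[ℂ] (H →L[ℂ] H))
    (s : Δp1 → Δp → ℤ)
    (U : Δp → G → H →L[ℂ] H)
    (hU : ∀ σ σ' g g', Commute (U σ g) (U σ' g'))
    (Ut : Δp1 → PDual G → H →L[ℂ] H)
    (hUt : ∀ τ τ' ρ ρ', Commute (Ut τ ρ) (Ut τ' ρ'))
    (u : Δp → G → A) (hu : ∀ σ g, U σ g = e (u σ g))
    (ut : Δp1 → PDual G → A) (hut : ∀ τ ρ, Ut τ ρ = e (ut τ ρ))
    (huhom : ∀ σ g g', u σ (g + g') = u σ g * u σ g')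
    (huthom : ∀ τ ρ ρ', ut τ (ρ + ρ') = ut τ ρ * ut τ ρ')
    (r : (Δp → PDual G) → (Δp1 → PDual G))
    (hr : ∀ k ∈ Set.range (bd (G := G) s), bd s (r k) = k)
    (SA : Finset Δp)
    (f₁ : ({σ // σ ∈ SA} → PDual G) → (Δp1 → PDual G))
    (f₂ : ({σ // σ ∈ SAᶜ} → PDual G) → (Δp1 → PDual G))
    (hsplit : ∀ k ∈ Set.range (bd (G := G) s),
      bd s (f₁ (restr SA k) + f₂ (restr SAᶜ k)) = k)
    (v : H)
    (hv1 : ∀ φ : Δp → G, cb s φ = 0 → Uop U hU φ v = v)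
    (hv2 : ∀ k' : Δp1 → PDual G, bd s k' = 0 → Utop Ut hUt k' v = v) :
    MC s U hU Ut hUt r v
      = (MCsub U hU Ut hUt SA f₁ (restr SA '' Set.range (bd (G := G) s))
          * MCsub U hU Ut hUt SAᶜ f₂ (restr SAᶜ '' Set.range (bd (G := G) s))) v := by
  classical
  haveI : Fintype (PDual G) := Fintype.ofFinite _
  have hadd : ∀ a b, Utop Ut hUt (a + b) = Utop Ut hUt a * Utop Ut hUt b := by
    intro a b
    simp only [Utop_eq e Ut hUt ut hut, ← map_mul, ← Finset.prod_mul_distrib, ← huthom]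
    rfl
  have hcomm : ∀ k a, Pop U hU k * Utop Ut hUt a = Utop Ut hUt a * Pop U hU k := by
    intro k a
    rw [Utop_eq e Ut hUt ut hut, Pop_eq e U hU u hu, ← map_mul, mul_comm, map_mul]
  have hterm : ∀ k a b, (PopSub U hU SA (restr SA k) * Utop Ut hUt a)
      * (PopSub U hU SAᶜ (restr SAᶜ k) * Utop Ut hUt b) = Pop U hU k * Utop Ut hUt (a + b) := by
    intro k a b
    rw [hadd]
    simp only [Utop_eq e Ut hUt ut hut, Pop_eq e U hU u hu, PopSub_eq e U hU u hu, ← map_mul]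
    rw [mul_mul_mul_comm, Finset.prod_mul_prod_compl]
  have heig : ∀ k φ, Pop U hU k * Uop U hU φ = expA (pairing k φ) • Pop U hU k := by
    intro k φ
    rw [Pop_eq e U hU u hu, Uop_eq e U hU u hu, ← map_mul, ← Finset.prod_mul_distrib,
      pairing, expA_sum, ← map_smul]
    simp only [fac_mul u huhom]
    rw [Finset.prod_smul]
  have hzero : ∀ k, k ∉ Set.range (bd (G := G) s) → Pop U hU k v = 0 := by
    intro k hk
    have : ∃ φ : Δp → G, cb s φ = 0 ∧ pairing k φ ≠ 0 := by
      by_contra hcon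
      push Not at hcon
      exact hk (mem_range_bd s k hcon)
    obtain ⟨φ, h1, h2⟩ := this
    have h3 := congrArg (fun T : H →L[ℂ] H => T v) (heig k φ)
    simp only [op_mul_apply, smul_apply, hv1 φ h1] at h3
    have h4 : (expA (pairing k φ) - 1) • Pop U hU k v = 0 := by
      rw [sub_smul, one_smul, ← h3, sub_self]
    rcases smul_eq_zero.1 h4 with h5 | h5
    · exact absurd (expA_eq_one (sub_eq_zero.1 h5)) h2
    · exact h5
  have hsame : ∀ a b, bd s a = bd s b → Utop Ut hUt a v = Utop Ut hUt b v := by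
    intro a b hab
    have h1 : a = b + (a - b) := by abel
    rw [h1, hadd, op_mul_apply, hv2 (a - b) (by rw [bd_sub, hab, sub_self])]
  unfold MC MCsub
  rw [op_mul_apply]
  simp only [finsum_mem_apply]
  trans ∑ p : ({σ // σ ∈ SA} → PDual G) × ({σ // σ ∈ SAᶜ} → PDual G),
      if p.1 ∈ restr SA '' Set.range (bd (G := G) s) then
        (PopSub U hU SA p.1 * Utop Ut hUt (f₁ p.1))
          (if p.2 ∈ restr SAᶜ '' Set.range (bd (G := G) s) then
            (PopSub U hU SAᶜ p.2 * Utop Ut hUt (f₂ p.2)) v else 0) else 0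
  swap
  · rw [Fintype.sum_prod_type]
    refine Finset.sum_congr rfl fun a _ => ?_
    by_cases ha : a ∈ restr SA '' Set.range (bd (G := G) s)
    · simp only [if_pos ha]
      rw [map_sum]
    · simp only [if_neg ha, Finset.sum_const_zero]
  refine Fintype.sum_bijective _ (restr_bij SA) _ _ ?_
  intro k
  dsimp only
  by_cases hk : k ∈ Set.range (bd (G := G) s)
  · rw [if_pos hk, if_pos (Set.mem_image_of_mem _ hk), if_pos (Set.mem_image_of_mem _ hk),
      ← op_mul_apply, hterm, op_mul_apply,
      op_mul_apply, hsame _ _ ((hr k hk).trans (hsplit k hk).symm)]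
  · rw [if_neg hk]
    split_ifs
    · rw [← op_mul_apply, hterm, hcomm, op_mul_apply,
        hzero k hk, map_zero]
    · rw [map_zero]
    · rfl

/-- **Theorem 1, operator form (factorization of the minimal coupling
operator)**: if `f₁`, `f₂` split the section of the boundary map across the
bipartition `(S_A, S_{A^c})`, `(T_A, T_B)`, then `𝒰 v = 𝒰_A 𝒰_{A^c} v` for
every vector `v` invariant under all `U(φ)`, `φ ∈ Z^p(G)`, and all `Ũ(k')`,
`k' ∈ Z_{p+1}(Ĝ)`. -/
theorem minimal_coupling_factorization [DecidableEq Δp] [DecidableEq Δp1]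
    (s : Δp1 → Δp → ℤ)
    (U : Δp → G → H →L[ℂ] H)
    (hU : ∀ σ σ' g g', Commute (U σ g) (U σ' g'))
    (hUhom : ∀ σ g g', U σ (g + g') = U σ g * U σ g')
    (hU0 : ∀ σ, U σ 0 = 1)
    (hUunit : ∀ σ g, star (U σ g) * U σ g = 1 ∧ U σ g * star (U σ g) = 1)
    (Ut : Δp1 → PDual G → H →L[ℂ] H)
    (hUt : ∀ τ τ' ρ ρ', Commute (Ut τ ρ) (Ut τ' ρ'))
    (hUthom : ∀ τ ρ ρ', Ut τ (ρ + ρ') = Ut τ ρ * Ut τ ρ')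
    (hUt0 : ∀ τ, Ut τ 0 = 1)
    (hUtunit : ∀ τ ρ, star (Ut τ ρ) * Ut τ ρ = 1 ∧ Ut τ ρ * star (Ut τ ρ) = 1)
    (hmix : ∀ σ τ g ρ, Commute (U σ g) (Ut τ ρ))
    (r : (Δp → PDual G) → (Δp1 → PDual G))
    (hr : ∀ k ∈ Set.range (bd (G := G) s), bd s (r k) = k)
    (SA : Finset Δp) (TA : Finset Δp1)
    (f₁ : ({σ // σ ∈ SA} → PDual G) → (Δp1 → PDual G))
    (hf₁supp : ∀ x τ, τ ∉ TA → f₁ x τ = 0)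
    (f₂ : ({σ // σ ∈ SAᶜ} → PDual G) → (Δp1 → PDual G))
    (hf₂supp : ∀ x τ, τ ∉ TAᶜ → f₂ x τ = 0)
    (hsplit : ∀ k ∈ Set.range (bd (G := G) s),
      bd s (f₁ (restr SA k) + f₂ (restr SAᶜ k)) = k)
    (v : H)
    (hv1 : ∀ φ : Δp → G, cb s φ = 0 → Uop U hU φ v = v)
    (hv2 : ∀ k' : Δp1 → PDual G, bd s k' = 0 → Utop Ut hUt k' v = v) :
    MC s U hU Ut hUt r v
      = (MCsub U hU Ut hUt SA f₁ (restr SA '' Set.range (bd (G := G) s))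
          * MCsub U hU Ut hUt SAᶜ f₂ (restr SAᶜ '' Set.range (bd (G := G) s))) v := by
  classical
  let X : Set (H →L[ℂ] H) := {x | (∃ σ g, x = U σ g) ∨ ∃ τ ρ, x = Ut τ ρ}
  have hX : ∀ a ∈ X, ∀ b ∈ X, a * b = b * a := by
    rintro a (⟨σ, g, rfl⟩ | ⟨τ, ρ, rfl⟩) b (⟨σ', g', rfl⟩ | ⟨τ', ρ', rfl⟩)
    · exact hU _ _ _ _
    · exact hmix _ _ _ _
    · exact (hmix _ _ _ _).symm
    · exact hUt _ _ _ _
  letI : CommRing (Algebra.adjoin ℂ X) := Algebra.adjoinCommRingOfComm ℂ hX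
  exact mc_aux (A := Algebra.adjoin ℂ X) (Algebra.adjoin ℂ X).val s U hU Ut hUt
    (fun σ g => ⟨U σ g, Algebra.subset_adjoin (Or.inl ⟨σ, g, rfl⟩)⟩) (fun _ _ => rfl)
    (fun τ ρ => ⟨Ut τ ρ, Algebra.subset_adjoin (Or.inr ⟨τ, ρ, rfl⟩)⟩) (fun _ _ => rfl)
    (fun σ g g' => Subtype.ext (hUhom σ g g')) (fun τ ρ ρ' => Subtype.ext (hUthom τ ρ ρ'))
    r hr SA f₁ f₂ hsplit v hv1 hv2
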